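/- Let Γ be a group and let α, β be distinct elements of Γ with αβ⁻¹ = βα⁻¹. Let (𝔾, s, t) ∈ 𝒟 with 𝔾 = (G⃗, ψ), and assume every arc of G⃗ incident to s leaves s. Then l(𝔾; s, t) = {α, β} if and only if 𝔾 is not balanced and 𝔾 is (s,t)-equivalent to a Γ-labeled graph 𝔾' = (G⃗, ψ') such that for every arc e⃗: ψ'(e⃗) ∈ {α, β} if e⃗ is incident to s, and ψ'(e⃗) ∈ {1_Γ, αβ⁻¹} otherwise. -/

import Mathlib

/-- A Γ-labeled graph: a finite loopless directed multigraph with arcs labeled by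
elements of a group Γ.  An arc is represented as a triple `(tail, head, label)`. -/
structure LGraph (V : Type) (Γ : Type) [Group Γ] where
  verts : Set V
  arcs : Set (V × V × Γ)
  verts_finite : verts.Finite
  arcs_finite : arcs.Finite
  tail_mem : ∀ a ∈ arcs, a.1 ∈ verts
  head_mem : ∀ a ∈ arcs, a.2.1 ∈ verts
  loopless : ∀ a ∈ arcs, a.1 ≠ a.2.1

namespace LGraph

variable {V : Type} {Γ : Type} [Group Γ]

/-- `connects a u v` : the arc `a` joins `u` and `v` (traversed from `u` to `v`,
in either direction of the arc). -/
def connects (a : V × V × Γ) (u v : V) : Prop :=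
  (a.1 = u ∧ a.2.1 = v) ∨ (a.1 = v ∧ a.2.1 = u)

/-- Walks in the underlying undirected graph of a Γ-labeled graph. -/
inductive Walk (G : LGraph V Γ) : V → V → Type
  | nil (v : V) : Walk G v v
  | cons (u v : V) {w : V} (a : V × V × Γ) (ha : a ∈ G.arcs)
      (hstep : connects a u v) (W : Walk G v w) : Walk G u w

variable [DecidableEq V]

/-- `ψ_𝔾(e, v)` : the label contributed by arc `a` when traversed arriving at `v` :
the arc's label if the arc enters `v`, its inverse if it leaves `v`. -/
def stepLabel (v : V) (a : V × V × Γ) : Γ :=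
  if a.2.1 = v then a.2.2 else a.2.2⁻¹

namespace Walk

variable {G : LGraph V Γ}

/-- The label `ψ_𝔾(W)` of a walk: the product of the step labels, later steps
multiplied on the left. -/
def label : {u w : V} → G.Walk u w → Γ
  | _, _, .nil _ => 1
  | _, _, .cons _ v a _ _ W => label W * stepLabel v a

/-- The list of vertices of a walk, in order. -/
def support : {u w : V} → G.Walk u w → List V
  | _, _, .nil v => [v]
  | _, _, .cons u _ _ _ _ W => u :: support W

/-- The list of traversed arcs of a walk, in order. -/
def arcsList : {u w : V} → G.Walk u w → List (V × V × Γ)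
  | _, _, .nil _ => []
  | _, _, .cons _ _ a _ _ W => a :: arcsList W

/-- The length (number of edges) of a walk. -/
def length : {u w : V} → G.Walk u w → ℕ
  | _, _, .nil _ => 0
  | _, _, .cons _ _ _ _ _ W => length W + 1

/-- A walk is a path if all its vertices are distinct. -/
def IsPath {u w : V} (W : G.Walk u w) : Prop := W.support.Nodup

/-- A closed walk is a cycle if it is nonempty, its edges are distinct and its
vertices (except for the repeated end vertex) are distinct. -/
def IsCycle {v : V} (W : G.Walk v v) : Prop :=
  1 ≤ W.length ∧ W.arcsList.Nodup ∧ W.support.dropLast.Nodup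

end Walk

/-- `l(𝔾; s, t)` : the set of all labels of s–t paths in `G`. -/
def labelSet (G : LGraph V Γ) (s t : V) : Set Γ :=
  {γ | ∃ P : G.Walk s t, P.IsPath ∧ P.label = γ}

/-- A Γ-labeled graph is balanced if every cycle has label `1`. -/
def Balanced (G : LGraph V Γ) : Prop :=
  ∀ (v : V) (C : G.Walk v v), C.IsCycle → C.label = 1

/-- Connectivity of (the underlying graph of) a Γ-labeled graph. -/
def Connected (G : LGraph V Γ) : Prop :=
  ∀ u ∈ G.verts, ∀ w ∈ G.verts, Nonempty (G.Walk u w)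

/-- `G` has no pair of equivalent arcs: no two distinct arcs that are parallel with
the same label, or antiparallel with mutually inverse labels. -/
def NoEquivArcs (G : LGraph V Γ) : Prop :=
  ∀ a ∈ G.arcs, ∀ b ∈ G.arcs, a ≠ b →
    ¬ ((a.1 = b.1 ∧ a.2.1 = b.2.1 ∧ a.2.2 = b.2.2) ∨
       (a.1 = b.2.1 ∧ a.2.1 = b.1 ∧ a.2.2 = b.2.2⁻¹))

/-- `(𝔾, s, t) ∈ 𝒟` : `s, t` are distinct vertices, every vertex lies on some
s–t path, and there are no equivalent arcs. -/
def MemD (G : LGraph V Γ) (s t : V) : Prop :=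
  s ≠ t ∧ s ∈ G.verts ∧ t ∈ G.verts ∧
  (∀ v ∈ G.verts, ∃ P : G.Walk s t, P.IsPath ∧ v ∈ P.support) ∧
  G.NoEquivArcs

/-- `(s,t)`-equivalence: `H` is obtained from `G` by shifting by `φ v` at each
vertex `v`, where `φ` vanishes at `s` and `t`. -/
def STEquiv (s t : V) (G H : LGraph V Γ) : Prop :=
  ∃ φ : V → Γ, φ s = 1 ∧ φ t = 1 ∧ H.verts = G.verts ∧
    H.arcs = (fun a : V × V × Γ => (a.1, a.2.1, φ a.2.1 * a.2.2 * (φ a.1)⁻¹)) '' G.arcs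

/-- The subgraph induced by a vertex set `X`. -/
def induce (G : LGraph V Γ) (X : Set V) : LGraph V Γ where
  verts := G.verts ∩ X
  arcs := {a ∈ G.arcs | a.1 ∈ X ∧ a.2.1 ∈ X}
  verts_finite := G.verts_finite.subset Set.inter_subset_left
  arcs_finite := G.arcs_finite.subset fun _ ha => ha.1
  tail_mem := fun a ha => ⟨G.tail_mem a ha.1, ha.2.1⟩
  head_mem := fun a ha => ⟨G.head_mem a ha.1, ha.2.2⟩
  loopless := fun a ha => G.loopless a ha.1

/-- `𝔾 − Y` : deletion of the vertex set `Y`. -/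
def delete (G : LGraph V Γ) (Y : Set V) : LGraph V Γ := G.induce Yᶜ

/-- `N_𝔾(X)` : the set of vertices outside `X` adjacent to `X`. -/
def nbhd (G : LGraph V Γ) (X : Set V) : Set V :=
  {y | y ∉ X ∧ ∃ x ∈ X, ∃ a ∈ G.arcs, connects a x y}

/-- `𝔾⟦X⟧` : the subgraph induced by `X ∪ N(X)` with the edges inside `N(X)` removed. -/
def around (G : LGraph V Γ) (X : Set V) : LGraph V Γ where
  verts := G.verts ∩ (X ∪ G.nbhd X)
  arcs := {a ∈ G.arcs | (a.1 ∈ X ∪ G.nbhd X) ∧ (a.2.1 ∈ X ∪ G.nbhd X) ∧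
            ¬ (a.1 ∈ G.nbhd X ∧ a.2.1 ∈ G.nbhd X)}
  verts_finite := G.verts_finite.subset Set.inter_subset_left
  arcs_finite := G.arcs_finite.subset fun _ ha => ha.1
  tail_mem := fun a ha => ⟨G.tail_mem a ha.1, ha.2.1⟩
  head_mem := fun a ha => ⟨G.head_mem a ha.1, ha.2.2.1⟩
  loopless := fun a ha => G.loopless a ha.1

/-- The arcs of `G` surviving the removal of the vertex set `X`. -/
def keptArcs (G : LGraph V Γ) (X : Set V) : Set (V × V × Γ) :=
  {a ∈ G.arcs | a.1 ∉ X ∧ a.2.1 ∉ X}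

/-- `A` contains an arc equivalent to an arc from `x` to `y` with label `γ`. -/
def hasEquivArc (A : Set (V × V × Γ)) (x y : V) (γ : Γ) : Prop :=
  (x, y, γ) ∈ A ∨ (y, x, γ⁻¹) ∈ A

/-- The new arcs added by a contraction of `X`, between `x` and `y`: an arc from `x`
to `y` with label `γ` for each `γ ∈ l(𝔾⟦X⟧; x, y)`, unless an equivalent arc
already exists among the kept arcs. -/
def newContractionArcs (G : LGraph V Γ) (X : Set V) (x y : V) : Set (V × V × Γ) :=
  {p | ∃ γ ∈ labelSet (G.around X) x y, p = (x, y, γ) ∧ ¬ hasEquivArc (G.keptArcs X) x y γ}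

/-- The arc set of the 2-contraction `𝔾 /₂ X`, where `N_𝔾(X) = {x, y}`. -/
def contract2Arcs (G : LGraph V Γ) (X : Set V) (x y : V) : Set (V × V × Γ) :=
  G.keptArcs X ∪ G.newContractionArcs X x y

/-- The arc set of the 3-contraction `𝔾 /₃ X`, where `N_𝔾(X) = {x, y, z}`. -/
def contract3Arcs (G : LGraph V Γ) (X : Set V) (x y z : V) : Set (V × V × Γ) :=
  G.keptArcs X ∪ G.newContractionArcs X x y ∪ G.newContractionArcs X y z ∪
    G.newContractionArcs X x z

/-- `X` is 2-contractible in `𝔾` (w.r.t. the terminals `s, t`). -/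
def TwoContractible (G : LGraph V Γ) (s t : V) (X : Set V) : Prop :=
  X ⊆ G.verts \ {s, t} ∧
  (∃ x y : V, x ≠ y ∧ G.nbhd X = {x, y}) ∧
  (G.around X).Connected ∧ G.around X ≠ G

/-- `X` is 3-contractible in `𝔾` (w.r.t. the terminals `s, t`). -/
def ThreeContractible (G : LGraph V Γ) (s t : V) (X : Set V) : Prop :=
  X ⊆ G.verts \ {s, t} ∧
  (∃ x y z : V, x ≠ y ∧ x ≠ z ∧ y ≠ z ∧ G.nbhd X = {x, y, z}) ∧
  (G.induce X).Connected ∧ (G.around X).Balanced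

/-- The graph obtained by adding a single `s`–`t` edge (with an arbitrary label). -/
def addEdge (G : LGraph V Γ) (s t : V) (hs : s ∈ G.verts) (ht : t ∈ G.verts)
    (hst : s ≠ t) : LGraph V Γ where
  verts := G.verts
  arcs := insert (s, t, (1 : Γ)) G.arcs
  verts_finite := G.verts_finite
  arcs_finite := G.arcs_finite.insert _
  tail_mem := by
    intro a ha
    rcases Set.mem_insert_iff.mp ha with rfl | h
    · exact hs
    · exact G.tail_mem a h
  head_mem := by
    intro a ha
    rcases Set.mem_insert_iff.mp ha with rfl | h
    · exact ht
    · exact G.head_mem a h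
  loopless := by
    intro a ha
    rcases Set.mem_insert_iff.mp ha with rfl | h
    · exact hst
    · exact G.loopless a h

/-- 2-connectivity: more than 2 vertices, and removing any single vertex leaves
the graph connected. -/
def TwoConnected (G : LGraph V Γ) : Prop :=
  2 < G.verts.ncard ∧ ∀ v : V, (G.delete {v}).Connected

/-- The effect of shifting by `α` at `v` on a single arc. -/
def shiftArc (v : V) (α : Γ) (a : V × V × Γ) : V × V × Γ :=
  (a.1, a.2.1, if a.2.1 = v then α * a.2.2 else if a.1 = v then a.2.2 * α⁻¹ else a.2.2)

/-- The graph obtained from `G` by shifting by `α` at `v`. -/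
def shift (G : LGraph V Γ) (v : V) (α : Γ) : LGraph V Γ where
  verts := G.verts
  arcs := shiftArc v α '' G.arcs
  verts_finite := G.verts_finite
  arcs_finite := G.arcs_finite.image _
  tail_mem := by rintro a ⟨b, hb, rfl⟩; exact G.tail_mem b hb
  head_mem := by rintro a ⟨b, hb, rfl⟩; exact G.head_mem b hb
  loopless := by rintro a ⟨b, hb, rfl⟩; exact G.loopless b hb

/-- The walk in `G.shift v α` corresponding to a walk in `G`. -/
def Walk.shiftMap {G : LGraph V Γ} (v : V) (α : Γ) :
    {u w : V} → G.Walk u w → (G.shift v α).Walk u w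
  | _, _, .nil x => .nil x
  | _, _, .cons u x a ha hstep W =>
      .cons u x (shiftArc v α a) (Set.mem_image_of_mem _ ha) hstep (Walk.shiftMap v α W)

end LGraph
namespace LGraph

theorem connects.symm {V Γ : Type} {a : V × V × Γ} {u v : V} (h : connects a u v) : connects a v u :=
  Or.symm h

variable {V Γ : Type} [Group Γ] {G : LGraph V Γ}

theorem connects.ne {a : V × V × Γ} {u v : V} (h : connects a u v) (ha : a ∈ G.arcs) : u ≠ v := by
  have := G.loopless a ha
  rcases h with ⟨rfl, rfl⟩ | ⟨rfl, rfl⟩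
  · exact this
  · exact this.symm

theorem stepLabel_symm [DecidableEq V] {a : V × V × Γ} {u v : V} (h : connects a u v)
    (ha : a ∈ G.arcs) : stepLabel u a = (stepLabel v a)⁻¹ := by
  have := G.loopless a ha
  rcases h with ⟨rfl, rfl⟩ | ⟨rfl, rfl⟩
  · simp [stepLabel, this.symm]
  · simp [stepLabel, this.symm]

namespace Walk

/-- Concatenation of walks. -/
def append : {u v w : V} → G.Walk u v → G.Walk v w → G.Walk u w
  | _, _, _, .nil _, Q => Q
  | _, _, _, .cons u v a ha h P, Q => .cons u v a ha h (append P Q)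

/-- The reversal of a walk. -/
def reverse : {u w : V} → G.Walk u w → G.Walk w u
  | _, _, .nil v => .nil v
  | _, _, .cons u v a ha h P => append (reverse P) (.cons v u a ha h.symm (.nil u))

theorem start_mem_support {u w : V} (P : G.Walk u w) : u ∈ P.support := by
  cases P <;> simp [support]

theorem end_mem_support {u w : V} (P : G.Walk u w) : w ∈ P.support := by
  induction P with
  | nil => simp [support]
  | cons u v a ha h P ih => simp [support, ih]

theorem mem_support_append {u v w z : V} (P : G.Walk u v) (Q : G.Walk v w) :
    z ∈ (P.append Q).support ↔ z ∈ P.support ∨ z ∈ Q.support := by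
  induction P with
  | nil v =>
    simp only [append, support, List.mem_singleton, iff_or_self]
    rintro rfl
    exact Q.start_mem_support
  | cons u v a ha h P ih => simp [append, support, ih, or_assoc]

theorem arcsList_append {u v w : V} (P : G.Walk u v) (Q : G.Walk v w) :
    (P.append Q).arcsList = P.arcsList ++ Q.arcsList := by
  induction P with
  | nil v => rfl
  | cons u v a ha h P ih => simp [append, arcsList, ih]

theorem mem_support_reverse {u w z : V} (P : G.Walk u w) :
    z ∈ P.reverse.support ↔ z ∈ P.support := by
  induction P with
  | nil v => rfl
  | cons u v a ha h P ih =>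
    simp only [reverse, mem_support_append, ih, support, List.mem_cons, List.not_mem_nil, or_false]
    constructor
    · rintro (h | rfl | rfl)
      · exact .inr h
      · exact .inr P.start_mem_support
      · exact .inl rfl
    · tauto

theorem arcsList_reverse {u w : V} (P : G.Walk u w) :
    P.reverse.arcsList = P.arcsList.reverse := by
  induction P with
  | nil v => rfl
  | cons u v a ha h P ih => simp [reverse, arcsList_append, arcsList, ih]

theorem arcsList_subset {u w : V} (P : G.Walk u w) : ∀ a ∈ P.arcsList, a ∈ G.arcs := by
  induction P with
  | nil v => simp [arcsList]
  | cons u v a ha h P ih => exact List.forall_mem_cons.2 ⟨ha, ih⟩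

theorem isPath_nil (v : V) : (nil v : G.Walk v v).IsPath := by simp [IsPath, support]

theorem isPath_cons {u v w : V} {a : V × V × Γ} {ha : a ∈ G.arcs} {h : connects a u v}
    {P : G.Walk v w} : (cons u v a ha h P).IsPath ↔ u ∉ P.support ∧ P.IsPath :=
  List.nodup_cons

theorem isPath_append {u v w : V} {P : G.Walk u v} {Q : G.Walk v w} :
    (P.append Q).IsPath ↔
      P.IsPath ∧ Q.IsPath ∧ ∀ z ∈ P.support, z ∈ Q.support → z = v := by
  induction P with
  | nil v => simp +contextual [append, support, isPath_nil]
  | cons u v a ha h P ih =>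
    simp only [append, isPath_cons, ih, mem_support_append, support, List.forall_mem_cons]
    constructor
    · rintro ⟨h₁, h₂, h₃, h₄⟩
      tauto
    · rintro ⟨⟨h₁, h₂⟩, h₃, h₄, h₅⟩
      refine ⟨?_, h₂, h₃, h₅⟩
      rintro (h | h)
      · exact h₁ h
      · exact h₁ (h₄ h ▸ P.end_mem_support)

theorem IsPath.reverse {u w : V} {P : G.Walk u w} (hP : P.IsPath) : P.reverse.IsPath := by
  induction P with
  | nil v => exact hP
  | cons u v a ha h P ih =>
    rw [isPath_cons] at hP
    simp only [Walk.reverse, isPath_append, isPath_cons, isPath_nil, support, mem_support_reverse,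
      List.mem_cons, List.not_mem_nil, or_false, and_true]
    refine ⟨ih hP.2, (h.ne ha).symm, ?_⟩
    rintro z hz (rfl | rfl)
    · rfl
    · exact absurd hz hP.1

theorem IsPath.eq_nil {u : V} {P : G.Walk u u} (hP : P.IsPath) : P = nil u := by
  cases P with
  | nil => rfl
  | cons _ v a ha h P => exact absurd P.end_mem_support (isPath_cons.1 hP).1

/-- A walk splits at each of its vertices. -/
theorem exists_eq_append {u w v : V} (P : G.Walk u w) (hv : v ∈ P.support) :
    ∃ (P₁ : G.Walk u v) (P₂ : G.Walk v w), P = P₁.append P₂ := by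
  induction P with
  | nil x =>
    obtain rfl : v = x := by simpa [support] using hv
    exact ⟨nil v, nil v, rfl⟩
  | cons u x a ha h P ih =>
    by_cases hvu : v = u
    · subst hvu
      exact ⟨nil v, _, rfl⟩
    · obtain ⟨P₁, P₂, rfl⟩ := ih (by simpa [support, hvu] using hv)
      exact ⟨cons u x a ha h P₁, P₂, rfl⟩

/-- A walk ending in `S` has an initial segment that meets `S` exactly in its last vertex. -/
theorem exists_first_hit {u w : V} (P : G.Walk u w) {S : Set V} (hw : w ∈ S) :
    ∃ y ∈ S, ∃ (P₁ : G.Walk u y) (P₂ : G.Walk y w), P = P₁.append P₂ ∧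
      ∀ z ∈ P₁.support, z ∈ S → z = y := by
  induction P with
  | nil x => exact ⟨x, hw, nil x, nil x, rfl, by simp [support]⟩
  | cons u x a ha h P ih =>
    by_cases hu : u ∈ S
    · exact ⟨u, hu, nil u, _, rfl, by simp [support]⟩
    · obtain ⟨y, hy, P₁, P₂, rfl, hP⟩ := ih hw
      refine ⟨y, hy, cons u x a ha h P₁, P₂, rfl, ?_⟩
      simp only [support, List.forall_mem_cons]
      exact ⟨fun h => absurd h hu, hP⟩

theorem mem_support_of_mem_arcsList {u w x y : V} {P : G.Walk u w} {a : V × V × Γ}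
    (ha : a ∈ P.arcsList) (hxy : connects a x y) : x ∈ P.support := by
  induction P with
  | nil v => simp [arcsList] at ha
  | cons u v b hb h P ih =>
    rcases List.mem_cons.1 ha with rfl | ha
    · have := P.start_mem_support
      simp only [support, List.mem_cons]
      rcases h with ⟨rfl, rfl⟩ | ⟨rfl, rfl⟩ <;> rcases hxy with ⟨rfl, rfl⟩ | ⟨rfl, rfl⟩ <;> simp [this]
    · exact List.mem_cons_of_mem _ (ih ha)

theorem IsPath.arcsList_nodup {u w : V} {P : G.Walk u w} (hP : P.IsPath) :
    P.arcsList.Nodup := by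
  induction P with
  | nil v => simp [arcsList]
  | cons u v a ha h P ih =>
    rw [isPath_cons] at hP
    exact List.nodup_cons.2 ⟨fun h' => hP.1 (mem_support_of_mem_arcsList h' h), ih hP.2⟩

theorem support_eq_dropLast_append {u w : V} (P : G.Walk u w) :
    P.support = P.support.dropLast ++ [w] := by
  induction P with
  | nil v => rfl
  | cons u v a ha h P ih =>
    have hne : P.support ≠ [] := List.ne_nil_of_mem P.start_mem_support
    rw [support, List.dropLast_cons_of_ne_nil hne, List.cons_append, ← ih]

theorem IsPath.isCycle_cons [DecidableEq V] {u v : V} {P : G.Walk v u} (hP : P.IsPath)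
    {a : V × V × Γ} (ha : a ∈ G.arcs) (h : connects a u v) (haP : a ∉ P.arcsList) :
    (cons u v a ha h P).IsCycle := by
  refine ⟨by simp [length], List.nodup_cons.2 ⟨haP, hP.arcsList_nodup⟩, ?_⟩
  have hne : P.support ≠ [] := List.ne_nil_of_mem P.start_mem_support
  rw [support, List.dropLast_cons_of_ne_nil hne]
  have := hP
  rw [IsPath, support_eq_dropLast_append, List.nodup_append] at this
  exact List.nodup_cons.2 ⟨fun h' => this.2.2 _ h' _ (by simp) rfl, this.1⟩

variable [DecidableEq V]

theorem label_append {u v w : V} (P : G.Walk u v) (Q : G.Walk v w) :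
    (P.append Q).label = Q.label * P.label := by
  induction P with
  | nil v => simp [append, label]
  | cons u v a ha h P ih => simp [append, label, ih, mul_assoc]

theorem label_reverse {u w : V} (P : G.Walk u w) : P.reverse.label = P.label⁻¹ := by
  induction P with
  | nil v => simp [reverse, label]
  | cons u v a ha h P ih => simp [reverse, label, label_append, ih, stepLabel_symm h ha]

end Walk

open Walk

section Balanced

variable [DecidableEq V]

theorem Balanced.label_mul_stepLabel (hG : G.Balanced) {u v : V} {P : G.Walk v u}
    (hP : P.IsPath) {a : V × V × Γ} (ha : a ∈ G.arcs) (h : connects a u v) :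
    P.label * stepLabel v a = 1 := by
  by_cases haP : a ∈ P.arcsList
  · cases P with
    | nil => simp [arcsList] at haP
    | cons _ x b hb hbx P =>
      rw [isPath_cons] at hP
      rcases List.mem_cons.1 haP with rfl | haP
      · obtain rfl : x = u := by
          have h₁ := h.ne ha
          have h₂ := hbx.ne ha
          rcases h with ⟨rfl, rfl⟩ | ⟨rfl, rfl⟩ <;> rcases hbx with ⟨h, h'⟩ | ⟨h, h'⟩ <;> simp_all
        rw [hP.2.eq_nil]
        simp [label, stepLabel_symm h ha]
      · exact absurd (mem_support_of_mem_arcsList haP h.symm) hP.1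
  · exact hG u _ (hP.isCycle_cons ha h haP)

/-- In a balanced graph, the label of a path agrees with the label of every walk with the same
ends. -/
theorem Balanced.label_eq (hG : G.Balanced) {u w : V} (W : G.Walk u w) {P : G.Walk u w}
    (hP : P.IsPath) : W.label = P.label := by
  induction W with
  | nil v => rw [hP.eq_nil]
  | cons u v a ha h W ih =>
    by_cases hv : v ∈ P.support
    · obtain ⟨P₁, P₂, rfl⟩ := P.exists_eq_append hv
      rw [isPath_append] at hP
      have := hG.label_mul_stepLabel hP.1.reverse ha h
      rw [label_reverse, inv_mul_eq_one] at this
      rw [label, label_append, ih hP.2.1, this]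
    · rw [label, ih (isPath_cons (ha := ha) (h := h.symm).2 ⟨hv, hP⟩), label,
        stepLabel_symm h ha]
      group

end Balanced

/-- The function `g` turns the label of the arc `a` into an element of `N`. -/
def Compat (N : Subgroup Γ) (g : V → Γ) (a : V × V × Γ) : Prop :=
  g a.2.1 * a.2.2 * (g a.1)⁻¹ ∈ N

section Compat

variable [DecidableEq V] {N : Subgroup Γ} {g : V → Γ}

theorem compat_iff_stepLabel {a : V × V × Γ} {u v : V} (h : connects a u v) (ha : a ∈ G.arcs) :
    Compat N g a ↔ g v * stepLabel v a * (g u)⁻¹ ∈ N := by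
  have := G.loopless a ha
  rcases h with ⟨rfl, rfl⟩ | ⟨rfl, rfl⟩
  · simp [Compat, stepLabel]
  · rw [Compat, ← inv_mem_iff]
    simp [stepLabel, this.symm, mul_assoc]

theorem Walk.label_mem_of_compat {u w : V} (W : G.Walk u w)
    (hW : ∀ a ∈ W.arcsList, Compat N g a) : g w * W.label * (g u)⁻¹ ∈ N := by
  induction W with
  | nil v => simp [label]
  | cons u v a ha h W ih =>
    rw [arcsList, List.forall_mem_cons, compat_iff_stepLabel h ha] at hW
    convert N.mul_mem (ih hW.2) hW.1 using 1
    simp [label, mul_assoc]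

/-- A function on the vertices that is compatible with the total label of a path can be changed
at the inner vertices so that it is compatible with every arc of the path. -/
theorem Walk.IsPath.exists_compat {u w : V} {P : G.Walk u w} (hP : P.IsPath) (huw : u ≠ w)
    (hg : g w * P.label * (g u)⁻¹ ∈ N) :
    ∃ g' : V → Γ, (∀ z, (z ∈ P.support → z = u ∨ z = w) → g' z = g z) ∧
      ∀ a ∈ P.arcsList, Compat N g' a := by
  induction P generalizing g with
  | nil v => exact absurd rfl huw
  | cons u v a ha h P ih =>
    rename_i w
    rw [isPath_cons] at hP
    by_cases hvw : v = w
    · subst hvw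
      rw [hP.2.eq_nil] at hg ⊢
      refine ⟨g, fun _ _ => rfl, ?_⟩
      simpa [arcsList, compat_iff_stepLabel h ha, label] using hg
    · obtain ⟨g', hg', hP'⟩ := ih (g := Function.update g v (g u * (stepLabel v a)⁻¹)) hP.2 hvw
        (by simpa [Function.update_of_ne (Ne.symm hvw), label, mul_assoc] using hg)
      refine ⟨g', fun z hz => ?_, ?_⟩
      · have hzv : z ≠ v := by
          rintro rfl
          rcases hz (List.mem_cons_of_mem _ P.start_mem_support) with h' | h'
          · exact h.ne ha h'.symm
          · exact hvw h'
        rw [hg', Function.update_of_ne hzv]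
        intro hzP
        rcases hz (List.mem_cons_of_mem _ hzP) with rfl | h'
        · exact absurd hzP hP.1
        · exact .inr h'
      · rw [arcsList, List.forall_mem_cons]
        refine ⟨?_, hP'⟩
        rw [compat_iff_stepLabel h ha, hg' v fun _ => .inl rfl,
          hg' u fun h' => absurd h' hP.1, Function.update_self,
          Function.update_of_ne (h.ne ha)]
        simp

end Compat

/-- The arcs `A` and vertices `U` form a subgraph of `G` in which every vertex lies on an
`s`–`t` path. -/
structure IsSTSubgraph (G : LGraph V Γ) (s t : V) (A : Set (V × V × Γ)) (U : Set V) : Prop where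
  subset : A ⊆ G.arcs
  tail_mem : ∀ a ∈ A, a.1 ∈ U
  head_mem : ∀ a ∈ A, a.2.1 ∈ U
  exists_path : ∀ v ∈ U, ∃ P : G.Walk s t, P.IsPath ∧ (∀ a ∈ P.arcsList, a ∈ A) ∧ v ∈ P.support
  start_mem : s ∈ U
  end_mem : t ∈ U

namespace IsSTSubgraph

variable {s t : V} {A : Set (V × V × Γ)} {U : Set V}

theorem support_subset (hA : G.IsSTSubgraph s t A U) {u w : V} {P : G.Walk u w} (hw : w ∈ U)
    (hP : ∀ a ∈ P.arcsList, a ∈ A) : ∀ z ∈ P.support, z ∈ U := by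
  induction P with
  | nil v => simpa [support] using hw
  | cons u v a ha h P ih =>
    rw [arcsList, List.forall_mem_cons] at hP
    rw [support, List.forall_mem_cons]
    refine ⟨?_, ih hw hP.2⟩
    rcases h with ⟨rfl, -⟩ | ⟨-, rfl⟩
    · exact hA.tail_mem a hP.1
    · exact hA.head_mem a hP.1

/-- Two distinct vertices can be joined to `s` and `t` by disjoint paths. -/
theorem exists_disjoint_paths (hA : G.IsSTSubgraph s t A U) {x y : V} (hx : x ∈ U) (hy : y ∈ U)
    (hxy : x ≠ y) :
    ∃ p q : V, (p = x ∧ q = y ∨ p = y ∧ q = x) ∧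
      ∃ (R : G.Walk s p) (Q : G.Walk q t), R.IsPath ∧ Q.IsPath ∧
        (∀ a ∈ R.arcsList, a ∈ A) ∧ (∀ a ∈ Q.arcsList, a ∈ A) ∧
        ∀ z ∈ R.support, z ∉ Q.support := by
  obtain ⟨P, hP, hPA, hxP⟩ := hA.exists_path x hx
  obtain ⟨b, hbP, B, hB, hBA, hxB⟩ : ∃ b ∈ P.support, ∃ B : G.Walk y b, B.IsPath ∧
      (∀ a ∈ B.arcsList, a ∈ A) ∧ x ∉ B.support := by
    obtain ⟨Q, hQ, hQA, hyQ⟩ := hA.exists_path y hy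
    obtain ⟨Q₁, Q₂, rfl⟩ := Q.exists_eq_append hyQ
    rw [isPath_append] at hQ
    simp only [arcsList_append, List.mem_append] at hQA
    by_cases hx₁ : x ∈ Q₁.support
    · exact ⟨t, P.end_mem_support, Q₂, hQ.2.1, fun a ha => hQA a (.inr ha),
        fun hx₂ => hxy (hQ.2.2 x hx₁ hx₂)⟩
    · refine ⟨s, P.start_mem_support, Q₁.reverse, hQ.1.reverse, fun a ha => hQA a (.inl ?_), ?_⟩
      · simpa [arcsList_reverse] using ha
      · rwa [mem_support_reverse]
  obtain ⟨c, hcP, C, D, rfl, hC⟩ := B.exists_first_hit (S := {z | z ∈ P.support}) hbP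
  simp only [isPath_append, arcsList_append, List.mem_append, mem_support_append, not_or]
    at hB hBA hxB
  obtain ⟨P₁, P₂, rfl⟩ := P.exists_eq_append hxP
  have hcx : c ≠ x := by
    rintro rfl
    exact hxB.1 C.end_mem_support
  simp only [isPath_append, arcsList_append, List.mem_append, mem_support_append,
    Set.mem_ofPred_eq] at hP hPA hcP hC
  rcases hcP with hc | hc
  · obtain ⟨P₁₁, P₁₂, rfl⟩ := P₁.exists_eq_append hc
    simp only [isPath_append, arcsList_append, List.mem_append, mem_support_append] at hP hPA hC hc
    refine ⟨y, x, .inr ⟨rfl, rfl⟩, P₁₁.append C.reverse, P₂, ?_, hP.2.1, ?_,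
      fun a ha => hPA a (.inr ha), ?_⟩
    · rw [isPath_append]
      refine ⟨hP.1.1, hB.1.reverse, fun z hz hz' => ?_⟩
      rw [mem_support_reverse] at hz'
      exact hC z hz' (.inl (.inl hz))
    · simp only [arcsList_append, arcsList_reverse, List.mem_append, List.mem_reverse]
      rintro a (ha | ha)
      · exact hPA a (.inl (.inl ha))
      · exact hBA a (.inl ha)
    · simp only [mem_support_append, mem_support_reverse]
      rintro z (hz | hz) hz₂
      · obtain rfl := hP.2.2 z (.inl hz) hz₂
        exact hcx (hP.1.2.2 z hz P₁₂.end_mem_support).symm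
      · obtain rfl := hC z hz (.inr hz₂)
        exact hcx (hP.2.2 z hc hz₂)
  · obtain ⟨P₂₁, P₂₂, rfl⟩ := P₂.exists_eq_append hc
    simp only [isPath_append, arcsList_append, List.mem_append, mem_support_append] at hP hPA hC hc
    refine ⟨x, y, .inl ⟨rfl, rfl⟩, P₁, C.append P₂₂, hP.1, ?_,
      fun a ha => hPA a (.inl ha), ?_, ?_⟩
    · rw [isPath_append]
      exact ⟨hB.1, hP.2.1.2.1, fun z hz hz' => hC z hz (.inr (.inr hz'))⟩
    · simp only [arcsList_append, List.mem_append]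
      rintro a (ha | ha)
      · exact hBA a (.inl ha)
      · exact hPA a (.inr (.inr ha))
    · simp only [mem_support_append]
      rintro z hz (hz₂ | hz₂)
      · obtain rfl := hC z hz₂ (.inl hz)
        exact hcx (hP.2.2 z hz hc)
      · obtain rfl := hP.2.2 z hz (.inr hz₂)
        exact hcx (hP.2.1.2.2 z P₂₁.start_mem_support hz₂).symm

/-- A proper `s`–`t` subgraph has an ear with an arc outside of it. -/
theorem exists_ear (hA : G.IsSTSubgraph s t A U)
    (hG : ∀ v ∈ G.verts, ∃ P : G.Walk s t, P.IsPath ∧ v ∈ P.support)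
    {a : V × V × Γ} (ha : a ∈ G.arcs) (haA : a ∉ A) :
    ∃ x ∈ U, ∃ y ∈ U, x ≠ y ∧ ∃ E : G.Walk x y, E.IsPath ∧
      (∀ z ∈ E.support, z ∈ U → z = x ∨ z = y) ∧ ∃ b ∈ E.arcsList, b ∉ A := by
  by_cases haU : a.1 ∈ U ∧ a.2.1 ∈ U
  · refine ⟨a.1, haU.1, a.2.1, haU.2, G.loopless a ha,
      cons _ _ a ha (.inl ⟨rfl, rfl⟩) (nil _), ?_, ?_, a, by simp [arcsList], haA⟩
    · exact isPath_cons.2 ⟨by simpa [support] using G.loopless a ha, isPath_nil _⟩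
    · simp +contextual [support]
  · obtain ⟨v, hvG, hvU⟩ : ∃ v ∈ G.verts, v ∉ U := by
      by_contra! h
      exact haU ⟨h _ (G.tail_mem a ha), h _ (G.head_mem a ha)⟩
    obtain ⟨P, hP, hvP⟩ := hG v hvG
    obtain ⟨P₁, P₂, rfl⟩ := P.exists_eq_append hvP
    obtain ⟨x, hx, X, X', hX, hXU⟩ := P₁.reverse.exists_first_hit hA.start_mem
    obtain ⟨y, hy, Y, Y', rfl, hYU⟩ := P₂.exists_first_hit hA.end_mem
    rw [isPath_append] at hP
    have hXP : ∀ z ∈ X.support, z ∈ P₁.support := by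
      intro z hz
      rw [← mem_support_reverse, hX, mem_support_append]
      exact .inl hz
    have hX' := hP.1.reverse
    rw [hX, isPath_append] at hX'
    have hXY : ∀ z ∈ X.support, z ∈ Y.support → z = v := fun z hz hz' =>
      hP.2.2 z (hXP z hz) ((mem_support_append _ _).2 (.inl hz'))
    have hY' := (isPath_append.1 hP.2.1).1
    refine ⟨x, hx, y, hy, ?_, X.reverse.append Y, ?_, ?_, ?_⟩
    · rintro rfl
      exact hvU (hXY x X.end_mem_support Y.end_mem_support ▸ hx)
    · rw [isPath_append]
      exact ⟨hX'.1.reverse, hY', fun z hz => hXY z ((mem_support_reverse _).1 hz)⟩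
    · simp only [mem_support_append, mem_support_reverse]
      rintro z (hz | hz) hzU
      · exact .inl (hXU z hz hzU)
      · exact .inr (hYU z hz hzU)
    · by_contra! h
      refine hvU (hA.support_subset hy (P := Y) (fun b hb => h b ?_) v Y.start_mem_support)
      simp [arcsList_append, hb]

variable [DecidableEq V] {N : Subgroup Γ} {g : V → Γ}

/-- Adding an ear to an `s`–`t` subgraph: the result is again an `s`–`t` subgraph, and compatible
functions extend to it, if the ear can be completed to an `s`–`t` path by disjoint paths. -/
theorem exists_add_ear_of_disjoint_paths (hA : G.IsSTSubgraph s t A U)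
    (hN : ∀ P : G.Walk s t, P.IsPath → g t * P.label * (g s)⁻¹ ∈ N)
    (hg : ∀ a ∈ A, Compat N g a) {x y : V} (hx : x ∈ U) (hy : y ∈ U) (hxy : x ≠ y)
    {E : G.Walk x y} (hE : E.IsPath) (hEU : ∀ z ∈ E.support, z ∈ U → z = x ∨ z = y)
    {R : G.Walk s x} {Q : G.Walk y t} (hR : R.IsPath) (hQ : Q.IsPath)
    (hRA : ∀ a ∈ R.arcsList, a ∈ A) (hQA : ∀ a ∈ Q.arcsList, a ∈ A)
    (hRQ : ∀ z ∈ R.support, z ∉ Q.support) :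
    G.IsSTSubgraph s t (A ∪ {a | a ∈ E.arcsList}) (U ∪ {z | z ∈ E.support}) ∧
      ∃ g' : V → Γ, g' s = g s ∧ g' t = g t ∧
        ∀ a ∈ A ∪ {a | a ∈ E.arcsList}, Compat N g' a := by
  have hRU := hA.support_subset hx hRA
  have hQU := hA.support_subset hA.end_mem hQA
  have hpath : (R.append (E.append Q)).IsPath := by
    simp only [isPath_append, mem_support_append]
    refine ⟨hR, ⟨hE, hQ, fun z hz hz' => ?_⟩, ?_⟩
    · rcases hEU z hz (hQU z hz') with rfl | rfl
      · exact absurd hz' (hRQ z R.end_mem_support)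
      · rfl
    · rintro z hz (hz' | hz')
      · rcases hEU z hz' (hRU z hz) with rfl | rfl
        · rfl
        · exact absurd Q.start_mem_support (hRQ z hz)
      · exact absurd hz' (hRQ z hz)
  constructor
  · refine ⟨?_, ?_, ?_, ?_, .inl hA.start_mem, .inl hA.end_mem⟩
    · exact Set.union_subset hA.subset E.arcsList_subset
    · rintro a (ha | ha)
      · exact .inl (hA.tail_mem a ha)
      · exact .inr (mem_support_of_mem_arcsList ha (.inl ⟨rfl, rfl⟩))
    · rintro a (ha | ha)
      · exact .inl (hA.head_mem a ha)
      · exact .inr (mem_support_of_mem_arcsList ha (.inr ⟨rfl, rfl⟩))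
    · rintro v (hv | hv)
      · obtain ⟨P, hP, hPA, hvP⟩ := hA.exists_path v hv
        exact ⟨P, hP, fun a ha => .inl (hPA a ha), hvP⟩
      · refine ⟨_, hpath, ?_, ?_⟩
        · simp only [arcsList_append, List.mem_append]
          rintro a (ha | ha | ha)
          · exact .inl (hRA a ha)
          · exact .inr ha
          · exact .inl (hQA a ha)
        · simp only [mem_support_append]
          exact .inr (.inl hv)
  · have hEN : g y * E.label * (g x)⁻¹ ∈ N := by
      have h₁ := R.label_mem_of_compat fun a ha => hg a (hRA a ha)
      have h₂ := Q.label_mem_of_compat fun a ha => hg a (hQA a ha)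
      have h₃ := hN _ hpath
      convert N.mul_mem (N.mul_mem (N.inv_mem h₂) h₃) (N.inv_mem h₁) using 1
      simp only [label_append]
      group
    obtain ⟨g', hg', hE'⟩ := hE.exists_compat hxy hEN
    have hU : ∀ z ∈ U, g' z = g z := fun z hz => hg' z fun hzE => hEU z hzE hz
    refine ⟨g', hU s hA.start_mem, hU t hA.end_mem, ?_⟩
    rintro a (ha | ha)
    · rw [Compat, hU _ (hA.head_mem a ha), hU _ (hA.tail_mem a ha)]
      exact hg a ha
    · exact hE' a ha

theorem exists_add_ear (hA : G.IsSTSubgraph s t A U)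
    (hN : ∀ P : G.Walk s t, P.IsPath → g t * P.label * (g s)⁻¹ ∈ N)
    (hg : ∀ a ∈ A, Compat N g a) {x y : V} (hx : x ∈ U) (hy : y ∈ U) (hxy : x ≠ y)
    {E : G.Walk x y} (hE : E.IsPath) (hEU : ∀ z ∈ E.support, z ∈ U → z = x ∨ z = y) :
    G.IsSTSubgraph s t (A ∪ {a | a ∈ E.arcsList}) (U ∪ {z | z ∈ E.support}) ∧
      ∃ g' : V → Γ, g' s = g s ∧ g' t = g t ∧
        ∀ a ∈ A ∪ {a | a ∈ E.arcsList}, Compat N g' a := by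
  obtain ⟨p, q, ⟨rfl, rfl⟩ | ⟨rfl, rfl⟩, R, Q, hR, hQ, hRA, hQA, hRQ⟩ :=
    hA.exists_disjoint_paths hx hy hxy
  · exact hA.exists_add_ear_of_disjoint_paths hN hg hx hy hxy hE hEU hR hQ hRA hQA hRQ
  · have := hA.exists_add_ear_of_disjoint_paths hN hg hy hx hxy.symm hE.reverse
      (fun z hz hzU => (hEU z ((mem_support_reverse E).1 hz) hzU).symm) hR hQ hRA hQA hRQ
    simpa only [arcsList_reverse, List.mem_reverse, mem_support_reverse] using this

end IsSTSubgraph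

variable [DecidableEq V]

/-- If every vertex lies on an `s`–`t` path and all `s`–`t` paths have their label in the coset
`N * α`, then all arcs can be shifted into `N` by a function with values `α` at `s` and
`1` at `t`. -/
theorem exists_forall_compat {s t : V} (hst : s ≠ t) (hs : s ∈ G.verts)
    (hG : ∀ v ∈ G.verts, ∃ P : G.Walk s t, P.IsPath ∧ v ∈ P.support) (N : Subgroup Γ) (α : Γ)
    (hN : ∀ P : G.Walk s t, P.IsPath → P.label * α⁻¹ ∈ N) :
    ∃ g : V → Γ, g s = α ∧ g t = 1 ∧ ∀ a ∈ G.arcs, Compat N g a := by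
  let F : Set (Set (V × V × Γ)) := {A | ∃ (U : Set V) (g : V → Γ), G.IsSTSubgraph s t A U ∧
    g s = α ∧ g t = 1 ∧ ∀ a ∈ A, Compat N g a}
  have hF : F.Finite := G.arcs_finite.finite_subsets.subset fun A ⟨_, _, h, _⟩ => h.subset
  have hne : F.Nonempty := by
    obtain ⟨P, hP, -⟩ := hG s hs
    obtain ⟨g, hg, hPg⟩ := hP.exists_compat (N := N) (g := Function.update (fun _ => 1) s α) hst
      (by simpa [Function.update_of_ne hst.symm] using hN P hP)
    refine ⟨{a | a ∈ P.arcsList}, {z | z ∈ P.support}, g, ⟨?_, ?_, ?_, ?_, ?_, ?_⟩, ?_, ?_, hPg⟩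
    · exact P.arcsList_subset
    · exact fun a ha => mem_support_of_mem_arcsList ha (.inl ⟨rfl, rfl⟩)
    · exact fun a ha => mem_support_of_mem_arcsList ha (.inr ⟨rfl, rfl⟩)
    · exact fun v hv => ⟨P, hP, fun _ h => h, hv⟩
    · exact P.start_mem_support
    · exact P.end_mem_support
    · simp [hg s fun _ => .inl rfl]
    · simp [hg t fun _ => .inr rfl, Function.update_of_ne hst.symm]
  obtain ⟨A, ⟨⟨U, g, hA, hgs, hgt, hg⟩, hmax⟩⟩ := hF.exists_maximal hne
  refine ⟨g, hgs, hgt, fun a ha => ?_⟩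
  by_cases haA : a ∈ A
  · exact hg a haA
  · obtain ⟨x, hx, y, hy, hxy, E, hE, hEU, b, hb, hbA⟩ := hA.exists_ear hG ha haA
    obtain ⟨hA', g', hgs', hgt', hg'⟩ := hA.exists_add_ear
      (by simpa [hgs, hgt] using hN) hg hx hy hxy hE hEU
    exact absurd (hmax ⟨_, g', hA', hgs'.trans hgs, hgt'.trans hgt, hg'⟩
      Set.subset_union_left (.inr hb)) hbA

/-- If all `s`–`t` paths have the same label, the graph is balanced. -/
theorem balanced_of_forall_label_eq {s t : V} (hst : s ≠ t) (hs : s ∈ G.verts)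
    (hG : ∀ v ∈ G.verts, ∃ P : G.Walk s t, P.IsPath ∧ v ∈ P.support) (α : Γ)
    (hα : ∀ P : G.Walk s t, P.IsPath → P.label = α) : G.Balanced := by
  obtain ⟨g, -, -, hg⟩ := exists_forall_compat hst hs hG ⊥ α fun P hP => by simp [hα P hP]
  intro v C _
  have := C.label_mem_of_compat fun a ha => hg a (C.arcsList_subset a ha)
  simpa using this

/-- The subgroup consisting of `1` and an element of order two. -/
def involutionSubgroup (γ : Γ) (hγ : γ * γ = 1) : Subgroup Γ where
  carrier := {1, γ}
  mul_mem' := by rintro _ _ (rfl | rfl) (rfl | rfl) <;> simp [hγ]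
  one_mem' := by simp
  inv_mem' := by
    rintro _ (rfl | rfl)
    · simp
    · simp [inv_eq_of_mul_eq_one_left hγ]

theorem mem_involutionSubgroup {γ : Γ} {hγ : γ * γ = 1} {x : Γ} :
    x ∈ involutionSubgroup γ hγ ↔ x = 1 ∨ x = γ := Iff.rfl

end LGraph

open LGraph in
/-- For distinct `α, β` with `αβ⁻¹ = βα⁻¹` and `(G, s, t) ∈ 𝒟` with all
arcs around `s` leaving `s`: `l(G; s, t) = {α, β}` iff `G` is not balanced and `G` is
(s,t)-equivalent to a graph in which every arc incident to `s` has label `α` or `β`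
and every other arc has label `1` or `αβ⁻¹`. -/
theorem two_labels_char_of_comm {V Γ : Type} [Group Γ] [DecidableEq V]
    (G : LGraph V Γ) (s t : V) (α β : Γ)
    (hne : α ≠ β) (hcomm : α * β⁻¹ = β * α⁻¹)
    (hD : G.MemD s t)
    (hleave : ∀ a ∈ G.arcs, a.2.1 ≠ s) :
    labelSet G s t = {α, β} ↔
      (¬ G.Balanced ∧
        ∃ G' : LGraph V Γ, STEquiv s t G G' ∧
          ∀ a ∈ G'.arcs,
            ((a.1 = s ∨ a.2.1 = s) → a.2.2 ∈ ({α, β} : Set Γ)) ∧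
            (¬ (a.1 = s ∨ a.2.1 = s) → a.2.2 ∈ ({1, α * β⁻¹} : Set Γ))) := by
  have hγ : (α * β⁻¹) * (α * β⁻¹) = 1 := by
    nth_rewrite 2 [hcomm]
    group
  have hγα : α * β⁻¹ * α = β := by
    rw [hcomm]
    group
  obtain ⟨hst, hs, -, hG, -⟩ := hD
  constructor
  · intro hl
    have hmem : ∀ γ ∈ ({α, β} : Set Γ), ∃ P : G.Walk s t, P.IsPath ∧ P.label = γ := by
      rw [← hl]
      exact fun γ hγ => hγ
    constructor
    · intro hbal
      obtain ⟨P, -, hPα⟩ := hmem α (by simp)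
      obtain ⟨Q, hQ, hQβ⟩ := hmem β (by simp)
      exact hne (by rw [← hPα, ← hQβ, hbal.label_eq P hQ])
    · obtain ⟨g, hgs, hgt, hg⟩ := exists_forall_compat hst hs hG (involutionSubgroup _ hγ) α
        (fun P hP => by
          have hP' : P.label ∈ labelSet G s t := ⟨P, hP, rfl⟩
          rw [hl] at hP'
          rw [mem_involutionSubgroup, mul_inv_eq_iff_eq_mul, mul_inv_eq_iff_eq_mul, hγα, one_mul]
          exact hP')
      let φ := Function.update g s 1
      let f := fun a : V × V × Γ => (a.1, a.2.1, φ a.2.1 * a.2.2 * (φ a.1)⁻¹)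
      refine ⟨⟨G.verts, f '' G.arcs, G.verts_finite, G.arcs_finite.image f, ?_, ?_, ?_⟩,
        ⟨φ, by simp [φ], by simp [φ, Function.update_of_ne hst.symm, hgt], rfl, rfl⟩, ?_⟩
      · rintro _ ⟨a, ha, rfl⟩
        exact G.tail_mem a ha
      · rintro _ ⟨a, ha, rfl⟩
        exact G.head_mem a ha
      · rintro _ ⟨a, ha, rfl⟩
        exact G.loopless a ha
      · rintro _ ⟨a, ha, rfl⟩
        have hhead := hleave a ha
        have hga := hg a ha
        rw [Compat, mem_involutionSubgroup] at hga
        simp only [f, φ, hhead, or_false, Function.update_of_ne hhead]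
        constructor
        · intro htail
          rw [htail, hgs, mul_inv_eq_iff_eq_mul, mul_inv_eq_iff_eq_mul, hγα, one_mul] at hga
          simpa [htail] using hga
        · intro htail
          rw [Function.update_of_ne htail]
          exact hga
  · rintro ⟨hbal, G', ⟨φ, hφs, hφt, -, hG'⟩, hlab⟩
    have hcompat : ∀ a ∈ G.arcs,
        Compat (involutionSubgroup _ hγ) (Function.update φ s α) a := by
      intro a ha
      have hhead := hleave a ha
      have h := hlab _ (hG' ▸ Set.mem_image_of_mem _ ha)
      simp only [hhead, or_false] at h
      rw [Compat, mem_involutionSubgroup, Function.update_of_ne hhead]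
      by_cases htail : a.1 = s
      · rw [htail, Function.update_self, mul_inv_eq_iff_eq_mul, mul_inv_eq_iff_eq_mul, hγα,
          one_mul]
        simpa [htail, hφs] using h.1 htail
      · rw [Function.update_of_ne htail]
        exact h.2 htail
    have hsub : ∀ P : G.Walk s t, P.label = α ∨ P.label = β := by
      intro P
      have := P.label_mem_of_compat fun a ha => hcompat a (P.arcsList_subset a ha)
      rwa [mem_involutionSubgroup, Function.update_self, Function.update_of_ne hst.symm, hφt,
        one_mul, mul_inv_eq_iff_eq_mul, mul_inv_eq_iff_eq_mul, hγα, one_mul] at this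
    apply Set.Subset.antisymm
    · rintro _ ⟨P, -, rfl⟩
      exact hsub P
    · rintro _ (rfl | rfl) <;> by_contra hnot
      · exact hbal (balanced_of_forall_label_eq hst hs hG β fun P hP =>
          (hsub P).resolve_left fun h => hnot ⟨P, hP, h⟩)
      · exact hbal (balanced_of_forall_label_eq hst hs hG α fun P hP =>
          (hsub P).resolve_right fun h => hnot ⟨P, hP, h⟩)
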